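/- Let ℒ be a distributive abstract logic. Then ℒ has no valid formula (a formula belonging to every theory) if and only if the empty set is a prime theory of ℒ; and ℒ has no inconsistent formula (a formula belonging to no theory) if and only if the set Expr of all formulas is a prime theory of ℒ. -/

import Mathlib

/-- An abstract logic: a nonempty family of theories on `Expr`
closed under intersections of nonempty subfamilies. -/
def IsAbstractLogic {Expr : Type*} (Th : Set (Set Expr)) : Prop :=
  Th.Nonempty ∧ ∀ 𝒯 ⊆ Th, 𝒯.Nonempty → ⋂₀ 𝒯 ∈ Th

/-- The logic is closed under chains: the union of every nonempty chain of
theories is a theory. -/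
def ChainClosed {Expr : Type*} (Th : Set (Set Expr)) : Prop :=
  ∀ 𝒯 ⊆ Th, 𝒯.Nonempty → IsChain (· ⊆ ·) 𝒯 → ⋃₀ 𝒯 ∈ Th

/-- A theory is totally prime if whenever it is the intersection of a nonempty
family of theories, it belongs to that family. -/
def TotallyPrimeTheory {Expr : Type*} (Th : Set (Set Expr)) (T : Set Expr) : Prop :=
  T ∈ Th ∧ ∀ 𝒯 ⊆ Th, 𝒯.Nonempty → T = ⋂₀ 𝒯 → T ∈ 𝒯

/-- A theory is prime if whenever it is the intersection of two theories,
it equals one of them. -/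
def PrimeTheory {Expr : Type*} (Th : Set (Set Expr)) (T : Set Expr) : Prop :=
  T ∈ Th ∧ ∀ T₁ ∈ Th, ∀ T₂ ∈ Th, T = T₁ ∩ T₂ → T = T₁ ∨ T = T₂

/-- A distributive abstract logic: an abstract logic closed under chains with
binary operations `vee` (disjunction) and `wedge` (conjunction) behaving as
expected on all totally prime theories. -/
def IsDistributiveLogic {Expr : Type*} (Th : Set (Set Expr))
    (vee wedge : Expr → Expr → Expr) : Prop :=
  IsAbstractLogic Th ∧ ChainClosed Th ∧
  (∀ T, TotallyPrimeTheory Th T → ∀ a b, vee a b ∈ T ↔ (a ∈ T ∨ b ∈ T)) ∧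
  (∀ T, TotallyPrimeTheory Th T → ∀ a b, wedge a b ∈ T ↔ (a ∈ T ∧ b ∈ T))

/-- In a chain-closed logic, a formula outside a theory is omitted by some totally prime
extension of that theory. -/
theorem ChainClosed.exists_totallyPrimeTheory {Expr : Type*} {Th : Set (Set Expr)}
    (hC : ChainClosed Th) {T : Set Expr} (hT : T ∈ Th) {x : Expr} (hx : x ∉ T) :
    ∃ M, TotallyPrimeTheory Th M ∧ T ⊆ M ∧ x ∉ M := by
  obtain ⟨M, hTM, hM⟩ := zorn_subset_nonempty {S | S ∈ Th ∧ x ∉ S}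
    (fun c hc hchain hne => ⟨⋃₀ c,
      ⟨hC c (fun S hS => (hc hS).1) hne hchain, fun ⟨S, hS, hxS⟩ => (hc hS).2 hxS⟩,
      fun S hS => Set.subset_sUnion_of_mem hS⟩) T ⟨hT, hx⟩
  refine ⟨M, ⟨hM.prop.1, fun 𝒯 h𝒯 _ hMeq => ?_⟩, hTM, hM.prop.2⟩
  have hxM : x ∉ ⋂₀ 𝒯 := hMeq ▸ hM.prop.2
  simp only [Set.mem_sInter, not_forall] at hxM
  obtain ⟨S, hS, hxS⟩ := hxM
  have hMS : M ⊆ S := hMeq.trans_subset (Set.sInter_subset_of_mem hS)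
  exact hMS.antisymm (hM.le_of_ge ⟨h𝒯 hS, hxS⟩ hMS) ▸ hS

namespace IsDistributiveLogic

variable {Expr : Type*} {Th : Set (Set Expr)} {vee wedge : Expr → Expr → Expr}

theorem vee_mem (hD : IsDistributiveLogic Th vee wedge) {T : Set Expr} (hT : T ∈ Th)
    {a b : Expr} (h : a ∈ T ∨ b ∈ T) : vee a b ∈ T := by
  by_contra hx
  obtain ⟨M, hM, hTM, hxM⟩ := hD.2.1.exists_totallyPrimeTheory hT hx
  exact hxM ((hD.2.2.1 M hM a b).2 (h.imp (@hTM a) (@hTM b)))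

theorem mem_of_wedge_mem (hD : IsDistributiveLogic Th vee wedge) {T : Set Expr} (hT : T ∈ Th)
    {a b : Expr} (h : wedge a b ∈ T) : a ∈ T ∧ b ∈ T := by
  constructor <;> by_contra hx <;>
    obtain ⟨M, hM, hTM, hxM⟩ := hD.2.1.exists_totallyPrimeTheory hT hx
  · exact hxM ((hD.2.2.2 M hM a b).1 (hTM h)).1
  · exact hxM ((hD.2.2.2 M hM a b).1 (hTM h)).2

theorem univ_mem (hD : IsDistributiveLogic Th vee wedge) (h : ∀ a, ∃ T ∈ Th, a ∈ T) :
    Set.univ ∈ Th := by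
  obtain ⟨A, -, hA⟩ := zorn_subset_nonempty {A | ∀ a, ∃ T ∈ Th, insert a A ⊆ T}
    (fun c hc hchain hne => by
      refine ⟨⋃₀ c, fun a => ?_, fun S hS => Set.subset_sUnion_of_mem hS⟩
      let f : Set Expr → Set Expr := fun A => ⋂₀ {T | T ∈ Th ∧ insert a A ⊆ T}
      have hf : ∀ A, insert a A ⊆ f A := fun A => Set.subset_sInter fun T hT => hT.2
      have hmono : Monotone f := fun A B hAB =>
        Set.sInter_subset_sInter fun T hT => ⟨hT.1, (Set.insert_subset_insert hAB).trans hT.2⟩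
      refine ⟨⋃₀ (f '' c), hD.2.1 _ ?_ (hne.image f) ?_, ?_⟩
      · rintro _ ⟨A, hA, rfl⟩
        exact hD.1.2 _ (fun T hT => hT.1) (hc hA a)
      · rintro _ ⟨A, hA, rfl⟩ _ ⟨B, hB, rfl⟩ -
        exact (hchain.total hA hB).imp (@hmono A B) (@hmono B A)
      · obtain ⟨B, hB⟩ := hne
        refine Set.insert_subset ⟨f B, ⟨B, hB, rfl⟩, hf B (Set.mem_insert _ _)⟩ ?_
        rintro y ⟨A, hA, hy⟩
        exact ⟨f A, ⟨A, hA, rfl⟩, hf A (Set.mem_insert_of_mem _ hy)⟩)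
    ∅ (fun a => by simpa using h a)
  have hAuniv : ∀ c, c ∈ A := fun c =>
    hA.le_of_ge (y := insert c A) (fun a => by
      obtain ⟨T, hT, hAT⟩ := hA.prop (wedge c a)
      rw [Set.insert_subset_iff] at hAT
      obtain ⟨hc, ha⟩ := hD.mem_of_wedge_mem hT hAT.1
      exact ⟨T, hT, Set.insert_subset ha (Set.insert_subset hc hAT.2)⟩)
      (Set.subset_insert c A) (Set.mem_insert c A)
  rcases isEmpty_or_nonempty Expr with _ | ⟨⟨a⟩⟩
  · obtain ⟨T, hT⟩ := hD.1.1
    exact Set.eq_univ_of_forall (s := T) (fun x => isEmptyElim x) ▸ hT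
  · obtain ⟨T, hT, hAT⟩ := hA.prop a
    exact Set.eq_univ_of_forall (fun x => hAT (Set.mem_insert_of_mem a (hAuniv x))) ▸ hT

end IsDistributiveLogic

/-- A distributive abstract logic has no valid formula iff the
empty set is a prime theory, and no inconsistent formula iff the set of all
formulas is a prime theory. -/
theorem empty_univ_prime_characterization {Expr : Type*} (Th : Set (Set Expr))
    (vee wedge : Expr → Expr → Expr) (hD : IsDistributiveLogic Th vee wedge) :
    ((¬ ∃ a : Expr, ∀ T ∈ Th, a ∈ T) ↔ PrimeTheory Th (∅ : Set Expr)) ∧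
    ((¬ ∃ a : Expr, ∀ T ∈ Th, a ∉ T) ↔ PrimeTheory Th (Set.univ : Set Expr)) := by
  refine ⟨⟨fun h => ⟨?_, fun T₁ h₁ T₂ h₂ h₁₂ => ?_⟩, fun h ⟨a, ha⟩ => ha ∅ h.1⟩,
    ⟨fun h => ⟨hD.univ_mem fun a => ?_, fun T₁ _ T₂ _ h₁₂ => Or.inl ?_⟩,
      fun h ⟨a, ha⟩ => ha Set.univ h.1 (Set.mem_univ a)⟩⟩
  · have hTh : ⋂₀ Th = ∅ := Set.eq_empty_of_forall_notMem fun a ha => h ⟨a, ha⟩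
    exact hTh ▸ hD.1.2 Th subset_rfl hD.1.1
  · by_contra! hne
    obtain ⟨a, ha⟩ := hne.1
    obtain ⟨b, hb⟩ := hne.2
    exact h₁₂.symm.subset ⟨hD.vee_mem h₁ (Or.inl ha), hD.vee_mem h₂ (Or.inr hb)⟩
  · by_contra! ha
    exact h ⟨a, ha⟩
  · exact (Set.univ_subset_iff.1 (h₁₂.subset.trans Set.inter_subset_left)).symm
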